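/- For all integers k ≥ 0 and n ≥ 0, f_{n+k,k} = k! · Σ_{n_0+n_1+...+n_k = n} (n!/(n_0!·n_1!·...·n_k!)) · f_{n_0}·f_{n_1}·...·f_{n_k}, where the sum is over all (k+1)-tuples (n_0,...,n_k) of nonnegative integers summing to n. -/

import Mathlib

/-- Stirling numbers of the second kind. -/
def S2 : ℕ → ℕ → ℕ
  | 0, 0 => 1
  | 0, _ + 1 => 0
  | _ + 1, 0 => 0
  | n + 1, k + 1 => (k + 1) * S2 n (k + 1) + S2 n k

/-- Generalized Fubini numbers: `f_{n,k} = ∑_{l=k}^n l! · S2(n-k, l-k)`. -/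
def genFubini (n k : ℕ) : ℕ :=
  ∑ l ∈ Finset.Icc k n, Nat.factorial l * S2 (n - k) (l - k)

/-- The Fubini numbers (ordered Bell numbers): `f_n = ∑_{k=0}^n k! · S2(n,k)`. -/
def fubini (n : ℕ) : ℕ :=
  ∑ k ∈ Finset.range (n + 1), Nat.factorial k * S2 n k

theorem S2_eq_zero_of_lt : ∀ {n k : ℕ}, n < k → S2 n k = 0
  | 0, _ + 1, _ => by simp [S2]
  | n + 1, k + 1, h => by
    rw [S2, S2_eq_zero_of_lt (by lia : n < k + 1), S2_eq_zero_of_lt (by lia : n < k), mul_zero]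

/-- `∑ m ≤ n, (m + k).choose k * m! * S2(n, m)`, the normalization `f_{n+k,k} / k!`. -/
def genFubiniNorm (k n : ℕ) : ℕ :=
  ∑ m ∈ Finset.range (n + 1), (m + k).choose k * m.factorial * S2 n m

theorem genFubini_add_eq (k n : ℕ) :
    genFubini (n + k) k = k.factorial * genFubiniNorm k n := by
  have h : Finset.Icc k (n + k) = (Finset.range (n + 1)).map (addRightEmbedding k) := by
    rw [Finset.range_eq_Ico, Finset.map_add_right_Ico]
    ext x
    simp only [Finset.mem_Icc, Finset.mem_Ico]
    lia
  rw [genFubini, genFubiniNorm, h, Finset.sum_map, Finset.mul_sum]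
  refine Finset.sum_congr rfl fun m _ => ?_
  simp only [addRightEmbedding_apply, Nat.add_sub_cancel]
  rw [← Nat.add_choose_mul_factorial_mul_factorial m k]
  ring

theorem genFubiniNorm_zero_left (n : ℕ) : genFubiniNorm 0 n = fubini n := by
  simp [genFubiniNorm, fubini]

theorem genFubiniNorm_zero_right (k : ℕ) : genFubiniNorm k 0 = 1 := by
  simp [genFubiniNorm, S2]

theorem genFubiniNorm_succ_right (k n : ℕ) :
    genFubiniNorm k (n + 1) + (k + 1) * genFubiniNorm k n =
      2 * (k + 1) * genFubiniNorm (k + 1) n := by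
  have shift : ∑ m ∈ Finset.range (n + 1),
        (m + 1 + k).choose k * (m + 1).factorial * ((m + 1) * S2 n (m + 1)) =
      ∑ m ∈ Finset.range (n + 1), (m + k).choose k * m.factorial * (m * S2 n m) := by
    have h := Finset.sum_range_succ'
      (fun m => (m + k).choose k * m.factorial * (m * S2 n m)) (n + 1)
    rw [Finset.sum_range_succ, S2_eq_zero_of_lt (Nat.lt_succ_self n)] at h
    simpa using h.symm
  have split : genFubiniNorm k (n + 1) =
      ∑ m ∈ Finset.range (n + 1), ((m + k).choose k * m.factorial * (m * S2 n m) +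
        (m + 1 + k).choose k * (m + 1).factorial * S2 n m) := by
    rw [genFubiniNorm, Finset.sum_range_succ', Finset.sum_add_distrib, ← shift,
      ← Finset.sum_add_distrib]
    simp only [S2, mul_add, mul_zero, add_zero]
  rw [split, genFubiniNorm, genFubiniNorm, Finset.mul_sum, Finset.mul_sum,
    ← Finset.sum_add_distrib]
  refine Finset.sum_congr rfl fun m _ => ?_
  have h₁ : (m + (k + 1)).choose (k + 1) * (k + 1) = (m + k + 1) * (m + k).choose k :=
    (Nat.add_one_mul_choose_eq (m + k) k).symm
  have h₂ : (m + 1 + k).choose k * (m + 1) = (m + k + 1) * (m + k).choose k := by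
    have h := Nat.choose_mul_succ_eq (m + k) k
    rw [show m + k + 1 - k = m + 1 by lia, show m + k + 1 = m + 1 + k by lia] at h
    rw [← h]
    ring
  rw [Nat.factorial_succ]
  linear_combination (m.factorial * S2 n m) * h₂ - 2 * (m.factorial * S2 n m) * h₁

open PowerSeries in
/-- The exponential generating function of the Fubini numbers, `1 / (2 - eˣ)`. -/
noncomputable def fubiniSeries : PowerSeries ℚ := (2 - exp ℚ)⁻¹

open PowerSeries in
theorem constantCoeff_two_sub_exp : constantCoeff (2 - exp ℚ) = 1 := by
  rw [map_sub, constantCoeff_exp, map_ofNat]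
  norm_num

open PowerSeries in
theorem derivative_fubiniSeries :
    derivative ℚ fubiniSeries = 2 * fubiniSeries ^ 2 - fubiniSeries := by
  have hmul : fubiniSeries * (2 - exp ℚ) = 1 :=
    PowerSeries.inv_mul_cancel _ (by rw [constantCoeff_two_sub_exp]; exact one_ne_zero)
  have htwo : derivative ℚ (2 : PowerSeries ℚ) = 0 := (derivative ℚ).map_natCast 2
  have h : derivative ℚ fubiniSeries = fubiniSeries ^ 2 * exp ℚ := by
    rw [fubiniSeries, derivative_inv', map_sub, htwo, derivative_exp]
    ring
  rw [h]
  linear_combination (-fubiniSeries) * hmul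

open PowerSeries in
theorem coeff_fubiniSeries_pow (k n : ℕ) :
    n.factorial * coeff n (fubiniSeries ^ (k + 1)) = genFubiniNorm k n := by
  induction n generalizing k with
  | zero =>
    rw [coeff_zero_eq_constantCoeff_apply, map_pow, fubiniSeries, constantCoeff_inv,
      constantCoeff_two_sub_exp, genFubiniNorm_zero_right]
    simp
  | succ n ih =>
    have hD : derivative ℚ (fubiniSeries ^ (k + 1)) =
        C (2 * (k + 1) : ℚ) * fubiniSeries ^ (k + 1 + 1) -
          C (k + 1 : ℚ) * fubiniSeries ^ (k + 1) := by
      rw [derivative_pow, derivative_fubiniSeries]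
      simp only [map_mul, map_add, map_natCast, map_one, map_ofNat, Nat.add_sub_cancel]
      push_cast
      ring
    have hc := congrArg (coeff n) hD
    rw [coeff_derivative, map_sub, coeff_C_mul, coeff_C_mul] at hc
    have hrec : (genFubiniNorm k (n + 1) + (k + 1) * genFubiniNorm k n : ℚ) =
        2 * (k + 1) * genFubiniNorm (k + 1) n := by
      exact_mod_cast genFubiniNorm_succ_right k n
    rw [Nat.factorial_succ]
    push_cast
    linear_combination n.factorial * hc - hrec + 2 * (k + 1) * ih (k + 1) - (k + 1) * ih k

open PowerSeries in
theorem coeff_fubiniSeries (n : ℕ) : coeff n fubiniSeries = fubini n / n.factorial := by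
  rw [eq_div_iff (by positivity), ← genFubiniNorm_zero_left, ← coeff_fubiniSeries_pow, mul_comm]
  simp

open PowerSeries in
theorem coeff_pow_eq_sum_antidiagonalTuple {R : Type*} [CommSemiring R] (f : PowerSeries R)
    (k n : ℕ) :
    coeff n (f ^ k) = ∑ v ∈ Finset.Nat.antidiagonalTuple k n, ∏ i, coeff (v i) f := by
  have h := coeff_prod (fun _ : Fin k => f) n Finset.univ
  rw [Finset.prod_const, Finset.card_univ, Fintype.card_fin] at h
  rw [h]
  refine Finset.sum_bij' (fun l _ => ⇑l) (fun v _ => Finsupp.equivFunOnFinite.symm v)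
    ?_ ?_ ?_ ?_ ?_ <;>
    simp [Finset.mem_finsuppAntidiag, Finset.Nat.mem_antidiagonalTuple]

theorem genFubini_convolution (k n : ℕ) :
    genFubini (n + k) k =
      Nat.factorial k * ∑ v ∈ Finset.Nat.antidiagonalTuple (k + 1) n,
        Nat.multinomial Finset.univ v * ∏ i, fubini (v i) := by
  rw [genFubini_add_eq]
  congr 1
  have h : (genFubiniNorm k n : ℚ) = ∑ v ∈ Finset.Nat.antidiagonalTuple (k + 1) n,
      (Nat.multinomial Finset.univ v * ∏ i, fubini (v i) : ℚ) := by
    rw [← coeff_fubiniSeries_pow, coeff_pow_eq_sum_antidiagonalTuple, Finset.mul_sum]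
    refine Finset.sum_congr rfl fun v hv => ?_
    have hspec := Nat.multinomial_spec Finset.univ v
    rw [Finset.Nat.mem_antidiagonalTuple.mp hv] at hspec
    have hne : (∏ i, ((v i).factorial : ℚ)) ≠ 0 :=
      Finset.prod_ne_zero_iff.mpr fun i _ => by positivity
    simp only [coeff_fubiniSeries]
    rw [Finset.prod_div_distrib, ← hspec]
    push_cast
    field_simp
  exact_mod_cast h
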